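/- Let t ≥ 3 and let G be a (P5,dart)-free finite simple graph containing an induced copy C of the complement of the (2t+1)-cycle, with vertices v1,...,v_{2t+1} such that v_i and v_j are adjacent if and only if their circular distance modulo 2t+1 is greater than 1. Then for every subset X of the vertices of C with t+1 ≤ |X| ≤ 2t, the set S(X) of vertices not on C whose set of neighbors on C equals X is a clique of G. -/

import Mathlib

open SimpleGraph

/-- `G` contains an induced subgraph isomorphic to `H`. -/
def ContainsInduced {V : Type*} {W : Type*} (G : SimpleGraph V) (H : SimpleGraph W) : Prop :=
  ∃ f : W ↪ V, ∀ a b, H.Adj a b ↔ G.Adj (f a) (f b)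

/-- The path on 5 vertices. -/
def P5 : SimpleGraph (Fin 5) := SimpleGraph.pathGraph 5

/-- The dart: vertices `0,1,2,3,4` and edges `01, 12, 23, 30, 02, 24`. -/
def dart : SimpleGraph (Fin 5) :=
  SimpleGraph.fromRel (fun a b =>
    (a, b) = (0, 1) ∨ (a, b) = (1, 2) ∨ (a, b) = (2, 3) ∨
    (a, b) = (3, 0) ∨ (a, b) = (0, 2) ∨ (a, b) = (2, 4))

/-- `G` is `k`-vertex-critical: `χ(G) = k` and `χ(G - v) < k` for every vertex `v`. -/
def IsVertexCritical {V : Type*} (G : SimpleGraph V) (k : ℕ) : Prop :=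
  G.chromaticNumber = k ∧
  ∀ v : V, (G.induce {u | u ≠ v}).chromaticNumber < k

/-- Five vertices with the adjacencies and non-adjacencies of the dart induce a dart. -/
theorem containsInduced_dart {V : Type*} {G : SimpleGraph V} {a b c d e : V}
    (hab : G.Adj a b) (hbc : G.Adj b c) (hcd : G.Adj c d) (hda : G.Adj d a) (hac : G.Adj a c)
    (hce : G.Adj c e) (hbd : ¬ G.Adj b d) (hae : ¬ G.Adj a e) (hbe : ¬ G.Adj b e)
    (hde : ¬ G.Adj d e) (hne : b ≠ d) : ContainsInduced G dart := by
  have hae' : a ≠ e := by rintro rfl; exact hbe hab.symm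
  have hbe' : b ≠ e := by rintro rfl; exact hae hab
  have hde' : d ≠ e := by rintro rfl; exact hae hda.symm
  refine ⟨⟨![a, b, c, d, e], ?_⟩, ?_⟩
  · intro i j h
    fin_cases i <;> fin_cases j <;>
      simp_all [hab.ne, hab.ne', hbc.ne, hbc.ne', hcd.ne, hcd.ne', hda.ne, hda.ne', hac.ne,
        hac.ne', hce.ne, hce.ne', hne.symm, hae'.symm, hbe'.symm, hde'.symm]
  · intro i j
    change _ ↔ G.Adj (![a, b, c, d, e] i) (![a, b, c, d, e] j)
    fin_cases i <;> fin_cases j <;>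
      simp [dart, hab, hab.symm, hbc, hbc.symm, hcd, hcd.symm, hda, hda.symm, hac, hac.symm,
        hce, hce.symm, hbd, hae, hbe, hde, G.adj_comm d b, G.adj_comm e]

/-- A nonempty proper subset of a cycle is entered at some point. -/
theorem exists_notMem_add_one_mem {n : ℕ} [NeZero n] {X : Set (Fin n)} (hX : X.Nonempty)
    (hX' : X ≠ Set.univ) : ∃ i, i ∉ X ∧ i + 1 ∈ X := by
  by_contra! h
  obtain ⟨i, hi⟩ := (Set.ne_univ_iff_exists_notMem X).1 hX'
  obtain ⟨j, hj⟩ := hX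
  have key (k : ℕ) : i + k • (1 : Fin n) ∉ X := by
    induction k with
    | zero => simpa using hi
    | succ k ih => rw [succ_nsmul, ← add_assoc]; exact h _ ih
  open scoped Fin.CommRing in
  apply key (j - i).val
  rw [nsmul_one, Fin.cast_val_eq_self, add_sub_cancel]
  exact hj

theorem antihole_SX_clique {V : Type} [Fintype V] (G : SimpleGraph V)
    (hP5 : ¬ ContainsInduced G P5) (hdart : ¬ ContainsInduced G dart)
    (t : ℕ) (ht : 3 ≤ t) (v : Fin (2 * t + 1) → V) (hinj : Function.Injective v)
    (hC : ∀ i j, G.Adj (v i) (v j) ↔ (i ≠ j ∧ j ≠ i + 1 ∧ i ≠ j + 1)) :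
    ∀ X : Set (Fin (2 * t + 1)), t + 1 ≤ X.ncard → X.ncard ≤ 2 * t →
      G.IsClique {u | u ∉ Set.range v ∧ ∀ i, G.Adj u (v i) ↔ i ∈ X} := by
  intro X hcard hcard' u hu w hw hne
  by_contra hadj
  have hX : X.Nonempty := by
    rw [← Set.ncard_pos]
    omega
  have hX' : X ≠ Set.univ := by
    rintro rfl
    simp at hcard'
  obtain ⟨i, hi, hi'⟩ := exists_notMem_add_one_mem hX hX'
  obtain ⟨j, hj, hj'⟩ : ∃ j ∈ X, j ∉ ({i - 1, i + 1, i + 1 + 1} : Set (Fin (2 * t + 1))) := by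
    by_contra! h
    have := Set.ncard_le_ncard (show X ⊆ {i - 1, i + 1, i + 1 + 1} from h)
    have := Set.ncard_insert_le (i - 1) {i + 1, i + 1 + 1}
    have := Set.ncard_insert_le (i + 1) {i + 1 + 1}
    rw [Set.ncard_singleton] at this
    omega
  simp only [Set.mem_insert_iff, Set.mem_singleton_iff, not_or] at hj'
  obtain ⟨h1, h2, h3⟩ := hj'
  have hji : j ≠ i := by rintro rfl; exact hi hj
  refine hdart (containsInduced_dart (a := v (i + 1)) (b := u) (c := v j) (d := w) (e := v i)
    ((hu.2 _).2 hi').symm ((hu.2 _).2 hj) ((hw.2 _).2 hj).symm ((hw.2 _).2 hi') ?_ ?_ hadj ?_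
    (fun h ↦ hi ((hu.2 _).1 h)) (fun h ↦ hi ((hw.2 _).1 h)) hne)
  · exact (hC _ _).2 ⟨Ne.symm h2, h3, fun h ↦ hji (add_right_cancel h).symm⟩
  · exact (hC _ _).2 ⟨hji, fun h ↦ h1 (eq_sub_of_add_eq h.symm), h2⟩
  · exact fun h ↦ ((hC _ _).1 h).2.2 rfl
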